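/- arXiv:2505.11029 — 3 statements merged into one kernel-verified Lean document; each statement's English description precedes it below -/
import Mathlib

section
/- For every real number v > 0, the modified Bessel function I_v is differentiable at every z > 0 with derivative I_v′(z) = I_{v−1}(z) − (v/z) · I_v(z). -/
/-- The modified Bessel function of the first kind of order `v`, defined for real `v`
and `z > 0` by `I_v(z) = ∑_{k=0}^∞ (z/2)^(2k+v) / (k! · Γ(k+v+1))`. -/
noncomputable def besselI (v z : ℝ) : ℝ :=
  ∑' k : ℕ, (z / 2) ^ (2 * (k : ℝ) + v) / ((k.factorial : ℝ) * Real.Gamma ((k : ℝ) + v + 1))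

/-- The `k`-th term of the power series defining `besselI v z`. -/
noncomputable def besselITerm (v z : ℝ) (k : ℕ) : ℝ :=
  (z / 2) ^ (2 * (k : ℝ) + v) / ((k.factorial : ℝ) * Real.Gamma ((k : ℝ) + v + 1))

lemma besselITerm_pos {v z : ℝ} (hv : -1 < v) (hz : 0 < z) (k : ℕ) : 0 < besselITerm v z k := by
  have hk : (0 : ℝ) ≤ k := k.cast_nonneg
  have hΓ : 0 < Real.Gamma ((k : ℝ) + v + 1) := Real.Gamma_pos_of_pos (by linarith)
  unfold besselITerm
  positivity

lemma besselITerm_succ {v z : ℝ} (hv : -1 < v) (hz : 0 < z) (k : ℕ) :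
    besselITerm v z (k + 1) =
      besselITerm v z k * ((z / 2) ^ 2 / (((k : ℝ) + 1) * ((k : ℝ) + v + 1))) := by
  have hk : (0 : ℝ) ≤ k := k.cast_nonneg
  have hkv : 0 < (k : ℝ) + v + 1 := by linarith
  have hΓ := (Real.Gamma_pos_of_pos hkv).ne'
  have hpow : (z / 2) ^ (2 * ((k : ℝ) + 1) + v) = (z / 2) ^ (2 * (k : ℝ) + v) * (z / 2) ^ 2 := by
    rw [← Real.rpow_natCast (z / 2) 2, ← Real.rpow_add (by positivity)]
    congr 1
    push_cast
    ring
  have hGamma : Real.Gamma ((k : ℝ) + 1 + v + 1) =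
      ((k : ℝ) + v + 1) * Real.Gamma ((k : ℝ) + v + 1) := by
    rw [← Real.Gamma_add_one hkv.ne']
    congr 1
    ring
  unfold besselITerm
  push_cast [Nat.factorial_succ]
  rw [hpow, hGamma]
  have := k.factorial_ne_zero
  field_simp

lemma summable_besselITerm {v z : ℝ} (hv : -1 < v) (hz : 0 < z) :
    Summable (besselITerm v z) := by
  refine summable_of_ratio_test_tendsto_lt_one (l := 0) one_pos
    (.of_forall fun k => (besselITerm_pos hv hz k).ne') ?_
  have hratio (k : ℕ) : ‖besselITerm v z (k + 1)‖ / ‖besselITerm v z k‖ =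
      (z / 2) ^ 2 / (((k : ℝ) + 1) * ((k : ℝ) + v + 1)) := by
    have h := besselITerm_pos hv hz k
    rw [Real.norm_of_nonneg (besselITerm_pos hv hz _).le, Real.norm_of_nonneg h.le,
      besselITerm_succ hv hz, mul_div_cancel_left₀ _ h.ne']
  simp_rw [hratio]
  refine Filter.Tendsto.const_div_atTop (Filter.Tendsto.atTop_mul_atTop₀ ?_ ?_) _
  · exact Filter.tendsto_atTop_add_const_right _ _ tendsto_natCast_atTop_atTop
  · exact Filter.tendsto_atTop_add_const_right _ _
      (Filter.tendsto_atTop_add_const_right _ _ tendsto_natCast_atTop_atTop)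

/-- On an interval `[a, b]` of positive reals, each term of the series is at most the sum of its
values at the endpoints, whatever the sign of the exponent. -/
lemma besselITerm_le_add {v a b y : ℝ} (hv : -1 < v) (ha : 0 < a) (hay : a ≤ y) (hyb : y ≤ b)
    (k : ℕ) : besselITerm v y k ≤ besselITerm v a k + besselITerm v b k := by
  have hk : (0 : ℝ) ≤ k := k.cast_nonneg
  have hΓ : 0 < Real.Gamma ((k : ℝ) + v + 1) := Real.Gamma_pos_of_pos (by linarith)
  have hy : 0 < y := ha.trans_le hay
  have hb : 0 < b := hy.trans_le hyb
  unfold besselITerm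
  rw [← add_div]
  gcongr
  rcases le_total 0 (2 * (k : ℝ) + v) with h | h
  · exact (Real.rpow_le_rpow (by positivity) (by gcongr) h).trans
      (le_add_of_nonneg_left (by positivity))
  · exact (Real.rpow_le_rpow_of_nonpos (by positivity) (by gcongr) h).trans
      (le_add_of_nonneg_right (by positivity))

lemma hasDerivAt_besselITerm {v z : ℝ} (hv : 0 < v) (hz : 0 < z) (k : ℕ) :
    HasDerivAt (fun z => besselITerm v z k)
      (besselITerm (v - 1) z k - v / z * besselITerm v z k) z := by
  have hk : (0 : ℝ) ≤ k := k.cast_nonneg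
  have hkv : 0 < (k : ℝ) + v := by linarith
  have hΓ := (Real.Gamma_pos_of_pos hkv).ne'
  have hderiv := (((hasDerivAt_id z).div_const 2).rpow_const (p := 2 * (k : ℝ) + v)
    (.inl (by simpa using hz.ne'))).div_const
    ((k.factorial : ℝ) * Real.Gamma ((k : ℝ) + v + 1))
  refine hderiv.congr_deriv ?_
  have hpow : (z / 2) ^ (2 * (k : ℝ) + v) = (z / 2) ^ (2 * (k : ℝ) + v - 1) * (z / 2) := by
    rw [← Real.rpow_add_one (by positivity)]
    congr 1
    ring
  unfold besselITerm
  rw [hpow, show (k : ℝ) + (v - 1) + 1 = k + v by ring,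
    show 2 * (k : ℝ) + (v - 1) = 2 * k + v - 1 by ring, Real.Gamma_add_one hkv.ne']
  have := k.factorial_ne_zero
  simp only [id]
  field_simp
  ring

theorem hasDerivAt_besselI_sub (v : ℝ) (hv : 0 < v) (z : ℝ) (hz : 0 < z) :
    HasDerivAt (fun z : ℝ => besselI v z) (besselI (v - 1) z - v / z * besselI v z) z := by
  have hv₀ : -1 < v := by linarith
  have hv₁ : -1 < v - 1 := by linarith
  have ha : 0 < z / 2 := by positivity
  have hb : 0 < 2 * z := by positivity
  have hmem : z ∈ Set.Ioo (z / 2) (2 * z) := ⟨by linarith, by linarith⟩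
  have hbound := ((summable_besselITerm hv₁ ha).add (summable_besselITerm hv₁ hb)).add
    (((summable_besselITerm hv₀ ha).add (summable_besselITerm hv₀ hb)).mul_left (v / (z / 2)))
  have hderiv := hasDerivAt_tsum_of_isPreconnected hbound isOpen_Ioo isPreconnected_Ioo
    (fun k y hy => hasDerivAt_besselITerm hv (ha.trans hy.1) k)
    (fun k y hy => ?_) hmem (summable_besselITerm hv₀ hz) hmem
  · rw [(summable_besselITerm hv₁ hz).tsum_sub ((summable_besselITerm hv₀ hz).mul_left _),
      tsum_mul_left] at hderiv
    exact hderiv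
  · have hy₀ : 0 < y := ha.trans hy.1
    have hpos₀ := besselITerm_pos hv₀ hy₀ k
    have hpos₁ := besselITerm_pos hv₁ hy₀ k
    refine (norm_sub_le _ _).trans ?_
    rw [Real.norm_of_nonneg hpos₁.le, Real.norm_of_nonneg (by positivity)]
    gcongr
    · exact besselITerm_le_add hv₁ ha hy.1.le hy.2.le k
    · exact hy.1.le
    · exact besselITerm_le_add hv₀ ha hy.1.le hy.2.le k
end

section
/- Let d ≥ 2 be an integer. The function κ ↦ ln C_d(κ) is differentiable at every κ > 0, and its derivative at κ equals −I_{d/2}(κ) / I_{d/2−1}(κ). -/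
/-- The von Mises–Fisher normalizing constant
`C_d(κ) = κ^(d/2−1) / ((2π)^(d/2) · I_{d/2−1}(κ))`. -/
noncomputable def vmfC (d : ℕ) (κ : ℝ) : ℝ :=
  κ ^ ((d : ℝ) / 2 - 1) / ((2 * Real.pi) ^ ((d : ℝ) / 2) * besselI ((d : ℝ) / 2 - 1) κ)

/-- The entire function `∑ x^k / (k! · Γ(k+v+1))`, which is `I_v(z) / (z/2)^v` at `x = (z/2)^2`. -/
noncomputable def besselAux (v x : ℝ) : ℝ :=
  ∑' k : ℕ, x ^ k / ((k.factorial : ℝ) * Real.Gamma ((k : ℝ) + v + 1))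

lemma Gamma_le_Gamma_natCast_add {v : ℝ} (hv : 0 ≤ v) (k : ℕ) :
    Real.Gamma (v + 1) ≤ Real.Gamma ((k : ℝ) + v + 1) := by
  induction k with
  | zero => simp
  | succ k ih =>
    have hk : (0 : ℝ) ≤ k := k.cast_nonneg
    have hpos : 0 < Real.Gamma ((k : ℝ) + v + 1) := Real.Gamma_pos_of_pos (by linarith)
    have hrec := Real.Gamma_add_one (s := (k : ℝ) + v + 1) (by linarith)
    have hcast : ((k + 1 : ℕ) : ℝ) + v + 1 = (k : ℝ) + v + 1 + 1 := by push_cast; ring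
    rw [hcast, hrec]
    nlinarith [mul_nonneg (add_nonneg hk hv) hpos.le]

lemma norm_besselAux_term_le {v R x : ℝ} (hv : 0 ≤ v) (hx : |x| ≤ R) (k : ℕ) :
    ‖x ^ k / ((k.factorial : ℝ) * Real.Gamma ((k : ℝ) + v + 1))‖ ≤
      R ^ k / k.factorial / Real.Gamma (v + 1) := by
  have hG : 0 < Real.Gamma (v + 1) := Real.Gamma_pos_of_pos (by linarith)
  have hGk := Gamma_le_Gamma_natCast_add hv k
  have hf : (0 : ℝ) < k.factorial := by exact_mod_cast k.factorial_pos
  rw [norm_div, norm_pow, Real.norm_eq_abs, Real.norm_eq_abs,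
    abs_of_pos (mul_pos hf (hG.trans_le hGk)), div_div]
  have hR : 0 ≤ R := (abs_nonneg x).trans hx
  gcongr

lemma summable_besselAux {v : ℝ} (hv : 0 ≤ v) (x : ℝ) :
    Summable fun k : ℕ => x ^ k / ((k.factorial : ℝ) * Real.Gamma ((k : ℝ) + v + 1)) :=
  .of_norm_bounded ((Real.summable_pow_div_factorial |x|).div_const _)
    (norm_besselAux_term_le hv le_rfl)

lemma besselAux_pos {v x : ℝ} (hv : 0 ≤ v) (hx : 0 < x) : 0 < besselAux v x := by
  have hG (k : ℕ) : 0 < Real.Gamma ((k : ℝ) + v + 1) := Real.Gamma_pos_of_pos (by positivity)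
  exact (summable_besselAux hv x).tsum_pos (fun k => have := hG k; by positivity) 0
    (have := hG 0; by positivity)

lemma besselAux_deriv_term_succ (v x : ℝ) (k : ℕ) :
    ((k + 1 : ℕ) : ℝ) * x ^ (k + 1 - 1) /
        (((k + 1).factorial : ℝ) * Real.Gamma (((k + 1 : ℕ) : ℝ) + v + 1)) =
      x ^ k / ((k.factorial : ℝ) * Real.Gamma ((k : ℝ) + (v + 1) + 1)) := by
  have h : ((k + 1 : ℕ) : ℝ) + v + 1 = (k : ℝ) + (v + 1) + 1 := by push_cast; ring
  have hk : ((k + 1 : ℕ) : ℝ) ≠ 0 := by positivity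
  rw [h, Nat.factorial_succ, Nat.cast_mul, Nat.add_sub_cancel, mul_assoc, mul_div_mul_left _ _ hk]

lemma hasDerivAt_besselAux {v : ℝ} (hv : 0 ≤ v) (x : ℝ) :
    HasDerivAt (besselAux v) (besselAux (v + 1) x) x := by
  set R := |x| + 1
  let u : ℕ → ℝ
    | 0 => 0
    | k + 1 => R ^ k / k.factorial / Real.Gamma (v + 1 + 1)
  have hu : Summable u :=
    (summable_nat_add_iff 1).mp ((Real.summable_pow_div_factorial R).div_const _)
  have hmem : x ∈ Metric.ball (0 : ℝ) R := by
    simp only [Metric.mem_ball, dist_zero_right, Real.norm_eq_abs]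
    exact lt_add_one |x|
  have hbound : ∀ (k : ℕ) (y : ℝ), y ∈ Metric.ball (0 : ℝ) R →
      ‖(k : ℝ) * y ^ (k - 1) / ((k.factorial : ℝ) * Real.Gamma ((k : ℝ) + v + 1))‖ ≤ u k := by
    rintro (_ | k) y hy
    · simp [u]
    · rw [besselAux_deriv_term_succ]
      rw [Metric.mem_ball, dist_zero_right] at hy
      exact norm_besselAux_term_le (by linarith) hy.le k
  have key := hasDerivAt_tsum_of_isPreconnected hu Metric.isOpen_ball
    (convex_ball (0 : ℝ) R).isPreconnected
    (fun k y _ => (hasDerivAt_pow k y).div_const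
      ((k.factorial : ℝ) * Real.Gamma ((k : ℝ) + v + 1)))
    hbound hmem (summable_besselAux hv x) hmem
  have hsum : Summable fun k : ℕ =>
      (k : ℝ) * x ^ (k - 1) / ((k.factorial : ℝ) * Real.Gamma ((k : ℝ) + v + 1)) :=
    .of_norm_bounded hu fun k => hbound k x hmem
  rw [hsum.tsum_eq_zero_add] at key
  simp only [besselAux_deriv_term_succ, Nat.cast_zero, zero_mul, zero_div, zero_add] at key
  exact key

lemma besselI_eq_rpow_mul_besselAux (v : ℝ) {z : ℝ} (hz : 0 < z) :
    besselI v z = (z / 2) ^ v * besselAux v ((z / 2) ^ 2) := by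
  rw [besselI, besselAux, ← tsum_mul_left]
  refine tsum_congr fun k => ?_
  have h : (z / 2) ^ (2 * (k : ℝ)) = ((z / 2) ^ 2) ^ k := by
    rw [← pow_mul, ← Real.rpow_natCast]; push_cast; rfl
  rw [Real.rpow_add (by positivity), h]
  ring

theorem hasDerivAt_log_vmfC (d : ℕ) (hd : 2 ≤ d) (κ : ℝ) (hκ : 0 < κ) :
    HasDerivAt (fun κ : ℝ => Real.log (vmfC d κ))
      (-(besselI ((d : ℝ) / 2) κ / besselI ((d : ℝ) / 2 - 1) κ)) κ := by
  obtain ⟨v, hv⟩ : ∃ v : ℝ, v = (d : ℝ) / 2 - 1 := ⟨_, rfl⟩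
  have hd' : (2 : ℝ) ≤ d := by exact_mod_cast hd
  have hv0 : 0 ≤ v := by linarith
  have hdv : (d : ℝ) / 2 = v + 1 := by linarith
  have hF := besselAux_pos hv0 (x := (κ / 2) ^ 2) (by positivity)
  have hC : ∀ z : ℝ, 0 < z → Real.log (vmfC d z) =
      Real.log (2 ^ v / (2 * Real.pi) ^ (v + 1)) - Real.log (besselAux v ((z / 2) ^ 2)) := by
    intro z hz
    have hFz := besselAux_pos hv0 (x := (z / 2) ^ 2) (by positivity)
    rw [← Real.log_div (by positivity) hFz.ne', vmfC, ← hv, hdv,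
      besselI_eq_rpow_mul_besselAux v hz, Real.div_rpow hz.le zero_le_two]
    congr 1
    field_simp
  have hsq : HasDerivAt (fun z : ℝ => (z / 2) ^ 2) (κ / 2) κ := by
    convert! ((hasDerivAt_id κ).div_const 2).pow 2 using 1
    simp
    ring
  have hder := (((hasDerivAt_besselAux hv0 _).comp κ hsq).log hF.ne').const_sub
    (Real.log (2 ^ v / (2 * Real.pi) ^ (v + 1)))
  rw [← hv, hdv, besselI_eq_rpow_mul_besselAux _ hκ, besselI_eq_rpow_mul_besselAux _ hκ,
    Real.rpow_add_one (by positivity)]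
  convert! hder.congr_of_eventuallyEq ((eventually_gt_nhds hκ).mono hC) using 1
  simp only [Function.comp_apply]
  field_simp
end

section
/- For every real number v ≥ 1/2 and every z > 0, the ratio of modified Bessel functions satisfies the two-sided bound z / (v − 1/2 + √((v + 1/2)² + z²)) < I_v(z) / I_{v−1}(z) < z / (v − 1/2 + √((v − 1/2)² + z²)). -/
open Real Set

/-- The entire function `x ↦ ∑ xᵏ / (k! Γ(k + w))`, which satisfies
`I_v(z) = (z/2)^v * besselSeries (v + 1) (z² / 4)`. -/
noncomputable def besselSeries (w x : ℝ) : ℝ :=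
  ∑' k : ℕ, x ^ k / ((k.factorial : ℝ) * Gamma ((k : ℝ) + w))

theorem Gamma_natCast_add_pos {w : ℝ} (hw : 0 < w) (k : ℕ) : 0 < Gamma ((k : ℝ) + w) :=
  Gamma_pos_of_pos (by positivity)

theorem Gamma_mul_pow_le_Gamma_natCast_add {w : ℝ} (hw : 0 < w) (k : ℕ) :
    Gamma w * min w 1 ^ k ≤ Gamma ((k : ℝ) + w) := by
  induction k with
  | zero => simp
  | succ k ih =>
    have hk : ((k + 1 : ℕ) : ℝ) + w = ((k : ℝ) + w) + 1 := by push_cast; ring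
    rw [hk, Gamma_add_one (by positivity), pow_succ, ← mul_assoc, mul_comm]
    have hmin : min w 1 ≤ (k : ℝ) + w := (min_le_left _ _).trans (by simp)
    have := Gamma_pos_of_pos hw
    gcongr

theorem summable_besselSeries {w : ℝ} (hw : 0 < w) (x : ℝ) :
    Summable fun k : ℕ => x ^ k / ((k.factorial : ℝ) * Gamma ((k : ℝ) + w)) := by
  have hm : 0 < min w 1 := lt_min hw one_pos
  have hG := Gamma_pos_of_pos hw
  refine Summable.of_norm_bounded
    ((summable_pow_div_factorial (|x| / min w 1)).mul_left (Gamma w)⁻¹) fun k => ?_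
  have hk := Gamma_natCast_add_pos hw k
  rw [norm_div, norm_pow, norm_eq_abs, norm_of_nonneg (by positivity)]
  calc |x| ^ k / ((k.factorial : ℝ) * Gamma ((k : ℝ) + w))
      ≤ |x| ^ k / ((k.factorial : ℝ) * (Gamma w * min w 1 ^ k)) := by
        gcongr
        exact Gamma_mul_pow_le_Gamma_natCast_add hw k
    _ = (Gamma w)⁻¹ * ((|x| / min w 1) ^ k / k.factorial) := by
        rw [div_pow]
        field_simp

theorem besselSeries_pos {w x : ℝ} (hw : 0 < w) (hx : 0 ≤ x) : 0 < besselSeries w x := by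
  refine (summable_besselSeries hw x).tsum_pos (fun k => ?_) 0 ?_
  · have := Gamma_natCast_add_pos hw k
    positivity
  · have := Gamma_natCast_add_pos hw 0
    simpa using this

theorem natCast_succ_mul_div_factorial_mul_Gamma (w y : ℝ) (k : ℕ) :
    ((k + 1 : ℕ) : ℝ) * y / (((k + 1).factorial : ℝ) * Gamma (((k + 1 : ℕ) : ℝ) + w)) =
      y / ((k.factorial : ℝ) * Gamma ((k : ℝ) + (w + 1))) := by
  have hk : ((k + 1 : ℕ) : ℝ) + w = (k : ℝ) + (w + 1) := by push_cast; ring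
  have h0 : ((k + 1 : ℕ) : ℝ) ≠ 0 := by positivity
  rw [hk, Nat.factorial_succ, Nat.cast_mul, mul_assoc, mul_div_mul_left _ _ h0]

theorem hasDerivAt_besselSeries {w : ℝ} (hw : 0 < w) (x : ℝ) :
    HasDerivAt (besselSeries w) (besselSeries (w + 1) x) x := by
  set R : ℝ := |x| + 1 with hR
  have hsum (y : ℝ) : Summable fun k : ℕ =>
      (k : ℝ) * y ^ (k - 1) / ((k.factorial : ℝ) * Gamma ((k : ℝ) + w)) := by
    rw [← summable_nat_add_iff 1]
    simpa only [natCast_succ_mul_div_factorial_mul_Gamma, Nat.add_sub_cancel]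
      using summable_besselSeries (by positivity) y
  have hmem : x ∈ Metric.ball (0 : ℝ) R := by simp [hR]
  have hderiv := hasDerivAt_tsum_of_isPreconnected (hsum R) Metric.isOpen_ball
    (convex_ball (0 : ℝ) R).isPreconnected
    (g := fun (k : ℕ) (y : ℝ) => y ^ k / ((k.factorial : ℝ) * Gamma ((k : ℝ) + w)))
    (fun k y _ => (hasDerivAt_pow k y).div_const _)
    (fun k y hy => by
      have hk := Gamma_natCast_add_pos hw k
      have hyR : |y| ≤ R := by simpa using (mem_ball_zero_iff.mp hy).le
      rw [norm_div, norm_mul, norm_pow, norm_eq_abs y, norm_of_nonneg (Nat.cast_nonneg k),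
        norm_of_nonneg (by positivity)]
      gcongr)
    hmem (summable_besselSeries hw x) hmem
  refine hderiv.congr_deriv ?_
  rw [(hsum x).tsum_eq_zero_add]
  simp only [natCast_succ_mul_div_factorial_mul_Gamma, Nat.add_sub_cancel]
  simp [besselSeries]

theorem besselSeries_recurrence {w : ℝ} (hw : 0 < w) (x : ℝ) :
    besselSeries w x = w * besselSeries (w + 1) x + x * besselSeries (w + 2) x := by
  have h1 := summable_besselSeries (w := w + 1) (by positivity) x
  have h2 := summable_besselSeries (w := w + 2) (by positivity) x
  have hterm (k : ℕ) : x ^ k / ((k.factorial : ℝ) * Gamma ((k : ℝ) + w)) =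
      w * (x ^ k / ((k.factorial : ℝ) * Gamma ((k : ℝ) + (w + 1)))) +
        (k : ℝ) * x ^ k / ((k.factorial : ℝ) * Gamma ((k : ℝ) + (w + 1))) := by
    have hk := (Gamma_natCast_add_pos hw k).ne'
    have hkw : (k : ℝ) + w ≠ 0 := by positivity
    rw [← add_assoc, Gamma_add_one hkw]
    field_simp
    ring
  have hshift (k : ℕ) : ((k + 1 : ℕ) : ℝ) * x ^ (k + 1) /
      (((k + 1).factorial : ℝ) * Gamma (((k + 1 : ℕ) : ℝ) + (w + 1))) =
      x * (x ^ k / ((k.factorial : ℝ) * Gamma ((k : ℝ) + (w + 2)))) := by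
    rw [natCast_succ_mul_div_factorial_mul_Gamma, show w + 1 + 1 = w + 2 by ring, pow_succ]
    ring
  have h3 : Summable fun k : ℕ =>
      (k : ℝ) * x ^ k / ((k.factorial : ℝ) * Gamma ((k : ℝ) + (w + 1))) := by
    rw [← summable_nat_add_iff 1]
    simpa only [hshift] using h2.mul_left x
  rw [besselSeries, tsum_congr hterm, (h1.mul_left w).tsum_add h3, tsum_mul_left,
    h3.tsum_eq_zero_add, tsum_congr hshift, tsum_mul_left]
  simp [besselSeries]

theorem mul_besselSeries_add_one_le {w x : ℝ} (hw : 0 < w) (hx : 0 ≤ x) :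
    w * besselSeries (w + 1) x ≤ besselSeries w x := by
  rw [besselSeries_recurrence hw x]
  have := besselSeries_pos (w := w + 2) (by positivity) hx
  exact le_add_of_nonneg_right (by positivity)

/-- Up to a positive factor, the derivative of `z ↦ I_w(z) / I_{w-1}(z)` at `z = 2√x`. -/
noncomputable def besselRiccati (w x : ℝ) : ℝ :=
  2 * besselSeries w x ^ 2 - 2 * x * besselSeries (w + 1) x ^ 2 -
    (2 * w - 1) * (besselSeries (w + 1) x * besselSeries w x)

theorem besselRiccati_pos_of_lt {w x : ℝ} (hw : 1 / 2 ≤ w) (hx : 0 ≤ x) (hxw : 2 * x < w) :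
    0 < besselRiccati w x := by
  have hw0 : 0 < w := by linarith
  have hS := besselSeries_pos (w := w + 1) (by positivity) hx
  have hST := mul_besselSeries_add_one_le hw0 hx
  unfold besselRiccati
  set S := besselSeries (w + 1) x
  set T := besselSeries w x
  have hT : 0 < T := (mul_pos hw0 hS).trans_le hST
  have h1 : 0 ≤ (2 * w - 1) * T * (T - w * S) :=
    mul_nonneg (mul_nonneg (by linarith) hT.le) (by linarith)
  have h2 : w * S ^ 2 ≤ S * T := by nlinarith
  have h3 : 2 * x * S ^ 2 < w * S ^ 2 := by gcongr
  have h4 : w * (S * T) ≤ T ^ 2 := by nlinarith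
  nlinarith [mul_lt_mul_of_pos_left (h3.trans_le h2) hw0]

theorem monotoneOn_rpow_mul_besselRiccati {w : ℝ} (hw : 1 / 2 ≤ w) :
    MonotoneOn (fun x => x ^ (w - 1 / 2) * besselRiccati w x) (Ioi 0) := by
  have hw0 : 0 < w := by linarith
  have hderiv {x : ℝ} (hx : 0 < x) :
      HasDerivAt (fun x => x ^ (w - 1 / 2) * besselRiccati w x)
        (x ^ (w - 1 / 2 - 1) *
          ((w - 1 / 2) * (besselSeries (w + 1) x * besselSeries w x))) x := by
    have hT := hasDerivAt_besselSeries hw0 x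
    have hS := hasDerivAt_besselSeries (w := w + 1) (by positivity) x
    rw [show w + 1 + 1 = w + 2 by ring] at hS
    have hG := (((hT.pow 2).const_mul 2).sub (((hasDerivAt_id x).const_mul 2).mul (hS.pow 2))).sub
      ((hS.mul hT).const_mul (2 * w - 1))
    refine ((hasDerivAt_rpow_const (p := w - 1 / 2) (Or.inl hx.ne')).mul hG).congr_deriv ?_
    have hrec := besselSeries_recurrence hw0 x
    have hpow : x ^ (w - 1 / 2) = x ^ (w - 1 / 2 - 1) * x := by
      rw [← rpow_add_one hx.ne']
      ring_nf
    simp only [id, Pi.pow_apply, Pi.mul_apply, Pi.sub_apply, hpow]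
    generalize x ^ (w - 1 / 2 - 1) = p
    generalize besselSeries (w + 2) x = U at *
    generalize besselSeries (w + 1) x = S at *
    rw [hrec]
    push_cast
    ring
  refine monotoneOn_of_deriv_nonneg (convex_Ioi 0)
    (fun x hx => (hderiv hx).continuousAt.continuousWithinAt) ?_ ?_
  · rw [interior_Ioi]
    exact fun x hx => (hderiv hx).differentiableAt.differentiableWithinAt
  · rw [interior_Ioi]
    intro x hx
    have hx : 0 < x := hx
    rw [(hderiv hx).deriv]
    have hT := besselSeries_pos hw0 hx.le
    have hS := besselSeries_pos (w := w + 1) (by positivity) hx.le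
    have : 0 ≤ w - 1 / 2 := by linarith
    positivity

theorem besselRiccati_pos {w x : ℝ} (hw : 1 / 2 ≤ w) (hx : 0 < x) : 0 < besselRiccati w x := by
  rcases lt_or_ge (2 * x) w with h | h
  · exact besselRiccati_pos_of_lt hw hx.le h
  · have hy : 0 < w / 4 := by linarith
    have hmono := monotoneOn_rpow_mul_besselRiccati hw (mem_Ioi.mpr hy) (mem_Ioi.mpr hx)
      (by linarith)
    have hpos := besselRiccati_pos_of_lt hw hy.le (by linarith)
    exact pos_of_mul_pos_right ((mul_pos (rpow_pos_of_pos hy _) hpos).trans_le hmono)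
      (rpow_nonneg hx.le _)

theorem besselSeries_add_one_mul_lt {w x : ℝ} (hw : 1 / 2 ≤ w) (hx : 0 < x) :
    besselSeries (w + 1) x * (w - 1 / 2 + √((w - 1 / 2) ^ 2 + 4 * x)) < 2 * besselSeries w x := by
  have hw0 : 0 < w := by linarith
  have hS := besselSeries_pos (w := w + 1) (by positivity) hx.le
  have hST := mul_besselSeries_add_one_le hw0 hx.le
  have hG := besselRiccati_pos hw hx
  unfold besselRiccati at hG
  set S := besselSeries (w + 1) x
  set T := besselSeries w x
  have hsq : √((w - 1 / 2) ^ 2 + 4 * x) ^ 2 = (w - 1 / 2) ^ 2 + 4 * x := sq_sqrt (by positivity)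
  have hlt : S * √((w - 1 / 2) ^ 2 + 4 * x) < 2 * T - (w - 1 / 2) * S := by
    refine lt_of_pow_lt_pow_left₀ 2 (by nlinarith) ?_
    rw [mul_pow, hsq]
    linarith
  linarith

theorem two_mul_besselSeries_lt {w x : ℝ} (hw : 0 < w) (hx : 0 < x) :
    2 * besselSeries w x < besselSeries (w + 1) x * (w - 1 / 2 + √((w + 1 / 2) ^ 2 + 4 * x)) := by
  have hU := besselSeries_add_one_mul_lt (w := w + 1) (by linarith) hx
  rw [show w + 1 + 1 = w + 2 by ring, show w + 1 - 1 / 2 = w + 1 / 2 by ring] at hU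
  rw [besselSeries_recurrence hw x]
  have hsq : √((w + 1 / 2) ^ 2 + 4 * x) ^ 2 = (w + 1 / 2) ^ 2 + 4 * x := sq_sqrt (by positivity)
  have hlt : w + 1 / 2 < √((w + 1 / 2) ^ 2 + 4 * x) := lt_sqrt_of_sq_lt (by linarith)
  linear_combination (1 / 2) * mul_lt_mul_of_pos_right hU (sub_pos.mpr hlt) -
    (1 / 2) * besselSeries (w + 2) x * hsq

theorem besselI_eq_rpow_mul_besselSeries (v : ℝ) {z : ℝ} (hz : 0 < z) :
    besselI v z = (z / 2) ^ v * besselSeries (v + 1) (z ^ 2 / 4) := by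
  rw [besselI, besselSeries, ← tsum_mul_left]
  refine tsum_congr fun k => ?_
  have hpow : (z / 2) ^ (2 * (k : ℝ) + v) = (z / 2) ^ v * (z ^ 2 / 4) ^ k := by
    rw [add_comm, rpow_add (by positivity), rpow_mul (by positivity), rpow_natCast]
    norm_num [div_pow]
  rw [hpow, add_assoc, mul_div_assoc]

theorem besselI_div_besselI_sub_one (v : ℝ) {z : ℝ} (hz : 0 < z) :
    besselI v z / besselI (v - 1) z =
      z * besselSeries (v + 1) (z ^ 2 / 4) / (2 * besselSeries v (z ^ 2 / 4)) := by
  have hp : (z / 2) ^ (v - 1) ≠ 0 := (rpow_pos_of_pos (by positivity) _).ne'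
  have hv : (z / 2) ^ v = (z / 2) ^ (v - 1) * (z / 2) := by
    rw [← rpow_add_one (by positivity), sub_add_cancel]
  rw [besselI_eq_rpow_mul_besselSeries v hz, besselI_eq_rpow_mul_besselSeries (v - 1) hz,
    sub_add_cancel, hv, mul_assoc, mul_div_mul_left _ _ hp]
  ring

theorem besselI_ratio_bounds (v : ℝ) (hv : 1 / 2 ≤ v) (z : ℝ) (hz : 0 < z) :
    z / (v - 1 / 2 + Real.sqrt ((v + 1 / 2) ^ 2 + z ^ 2)) < besselI v z / besselI (v - 1) z ∧
      besselI v z / besselI (v - 1) z < z / (v - 1 / 2 + Real.sqrt ((v - 1 / 2) ^ 2 + z ^ 2)) := by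
  have hv0 : 0 < v := by linarith
  have hx : 0 < z ^ 2 / 4 := by positivity
  have hlower := two_mul_besselSeries_lt hv0 hx
  have hupper := besselSeries_add_one_mul_lt hv hx
  rw [mul_div_cancel₀ _ (four_ne_zero' ℝ)] at hlower hupper
  have hT := besselSeries_pos hv0 hx.le
  have hd : 0 ≤ v - 1 / 2 := by linarith
  rw [besselI_div_besselI_sub_one v hz]
  constructor
  · rw [div_lt_div_iff₀ (by positivity) (by positivity), mul_assoc]
    gcongr
  · rw [div_lt_div_iff₀ (by positivity) (by positivity), mul_assoc]
    gcongr
end
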